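/- Let X be a Polish path space with N time steps and μ, μ̃ ∈ P(X). Then the total variation and the adapted variation satisfy ‖μ − μ̃‖_TV ≤ ‖μ − μ̃‖_AV ≤ (2^N − 1) ‖μ − μ̃‖_TV. -/

import Mathlib

open MeasureTheory ProbabilityTheory Filter Set
open scoped ENNReal NNReal Topology ProbabilityTheory

noncomputable section

namespace AOT

variable {N : ℕ}

/-- The σ-algebra on a path space generated by the `t`-th coordinate. -/
def coordσ (X : Fin N → Type*) [∀ t, MeasurableSpace (X t)] (t : Fin N) :
    MeasurableSpace (∀ s, X s) :=
  MeasurableSpace.comap (fun x => x t) inferInstance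

/-- The σ-algebra generated by the coordinates (strictly) before time `t`, from a family
of coordinate σ-algebras. -/
def pastσOf {A : Type*} (m : Fin N → MeasurableSpace A) (t : ℕ) : MeasurableSpace A :=
  ⨆ s : Fin N, ⨆ _ : (s : ℕ) < t, m s

/-- The σ-algebra on a path space generated by the coordinates before time `t`. -/
def pastσ (X : Fin N → Type*) [∀ t, MeasurableSpace (X t)] (t : ℕ) :
    MeasurableSpace (∀ s, X s) :=
  pastσOf (coordσ X) t

/-- Conditional independence of the sub-σ-algebras `m₁` and `m₂` given `m₃`, under the
measure `π`: for all sets `A ∈ m₁`, `B ∈ m₂`, the conditional expectation (given `m₃`)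
of the indicator of `A ∩ B` is a.s. the product of those of `A` and of `B`. -/
def CondIndepσ {Ω : Type*} {mΩ : MeasurableSpace Ω} (m₁ m₂ m₃ : MeasurableSpace Ω)
    (π : @Measure Ω mΩ) : Prop :=
  ∀ A B : Set Ω, MeasurableSet[m₁] A → MeasurableSet[m₂] B →
    (π[(A ∩ B).indicator (fun _ => (1 : ℝ)) | m₃]) =ᵐ[π]
      (π[A.indicator (fun _ => (1 : ℝ)) | m₃]) * (π[B.indicator (fun _ => (1 : ℝ)) | m₃])

/-- Causality of a measure on `A × B` relative to families of coordinate σ-algebras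
`mA` on `A` and `mB` on `B`: for every time `t`, the `t`-th coordinate of the first
component is conditionally independent of the (strict) past of the second component,
given the (strict) past of the first component. -/
def IsCausalFor {A B : Type*} [MeasurableSpace A] [MeasurableSpace B]
    (mA : Fin N → MeasurableSpace A) (mB : Fin N → MeasurableSpace B)
    (π : Measure (A × B)) : Prop :=
  ∀ t : Fin N,
    CondIndepσ ((mA t).comap Prod.fst)
      ((pastσOf mB (t : ℕ)).comap Prod.snd)
      ((pastσOf mA (t : ℕ)).comap Prod.fst) π

/-- Anticausality: causality with the roles of the two components exchanged. -/
def IsAnticausalFor {A B : Type*} [MeasurableSpace A] [MeasurableSpace B]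
    (mA : Fin N → MeasurableSpace A) (mB : Fin N → MeasurableSpace B)
    (π : Measure (A × B)) : Prop :=
  IsCausalFor mB mA (π.map Prod.swap)

/-- A coupling of a measure on `X₁ × ⋯ × X_N` and a measure on `Y₁ × ⋯ × Y_N` is causal if
under it, for every `t`, `Y_{1:t}` is conditionally independent of `X_{t+1}` given `X_{1:t}`. -/
def IsCausal {X Y : Fin N → Type*} [∀ t, MeasurableSpace (X t)] [∀ t, MeasurableSpace (Y t)]
    (π : Measure ((∀ t, X t) × (∀ t, Y t))) : Prop :=
  IsCausalFor (coordσ X) (coordσ Y) π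

def IsAnticausal {X Y : Fin N → Type*} [∀ t, MeasurableSpace (X t)] [∀ t, MeasurableSpace (Y t)]
    (π : Measure ((∀ t, X t) × (∀ t, Y t))) : Prop :=
  IsAnticausalFor (coordσ X) (coordσ Y) π

def IsBicausal {X Y : Fin N → Type*} [∀ t, MeasurableSpace (X t)] [∀ t, MeasurableSpace (Y t)]
    (π : Measure ((∀ t, X t) × (∀ t, Y t))) : Prop :=
  IsCausal π ∧ IsAnticausal π

/-- `π` is a coupling of `μ` and `ν`. -/
def IsCoupling {A B : Type*} [MeasurableSpace A] [MeasurableSpace B]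
    (μ : Measure A) (ν : Measure B) (π : Measure (A × B)) : Prop :=
  π.map Prod.fst = μ ∧ π.map Prod.snd = ν

/-- The four flavors of (adapted) optimal transport: plain, causal, anticausal, bicausal. -/
inductive Flavor | plain | causal | anticausal | bicausal

/-- The adaptedness constraint corresponding to a flavor. -/
def IsAdapted {X Y : Fin N → Type*} [∀ t, MeasurableSpace (X t)] [∀ t, MeasurableSpace (Y t)] :
    Flavor → Measure ((∀ t, X t) × (∀ t, Y t)) → Prop
  | .plain => fun _ => True
  | .causal => fun π => IsCausal π
  | .anticausal => fun π => IsAnticausal π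
  | .bicausal => fun π => IsBicausal π

/-- The set `Π_•(μ, ν)` of couplings of `μ` and `ν` with the adaptedness constraint
given by the flavor `b`. -/
def aCouplings {X Y : Fin N → Type*} [∀ t, MeasurableSpace (X t)] [∀ t, MeasurableSpace (Y t)]
    (b : Flavor) (μ : Measure (∀ t, X t)) (ν : Measure (∀ t, Y t)) :
    Set (Measure ((∀ t, X t) × (∀ t, Y t))) :=
  {π | IsCoupling μ ν π ∧ IsAdapted b π}

/-- `p`-th power transport cost of a coupling. -/
def lcost (p : ℝ) {A : Type*} [MeasurableSpace A] [PseudoEMetricSpace A]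
    (π : Measure (A × A)) : ℝ≥0∞ :=
  ∫⁻ z, edist z.1 z.2 ^ p ∂π

/-- The (adapted) Wasserstein distance `W_{p,•}` between two measures on a path space. -/
def W {X : Fin N → Type*} [∀ t, MeasurableSpace (X t)] [∀ t, PseudoEMetricSpace (X t)]
    (p : ℝ) (b : Flavor) (μ ν : Measure (∀ t, X t)) : ℝ≥0∞ :=
  (⨅ π : aCouplings b μ ν, lcost p π.1) ^ (1 / p)

/-- Coordinate σ-algebras on `X × Y` viewed as a single path space with
coordinates `X_t × Y_t`. -/
def coordσ2 (X Y : Fin N → Type*) [∀ t, MeasurableSpace (X t)] [∀ t, MeasurableSpace (Y t)]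
    (t : Fin N) : MeasurableSpace ((∀ s, X s) × (∀ s, Y s)) :=
  ((coordσ X t).comap Prod.fst) ⊔ ((coordσ Y t).comap Prod.snd)

/-- Adaptedness for measures on `(X × Y) × (X × Y)`, where `X × Y` is regarded as a single
path space with `N` time steps, the `t`-th coordinate being `X_t × Y_t`. -/
def IsAdapted2 {X Y : Fin N → Type*} [∀ t, MeasurableSpace (X t)] [∀ t, MeasurableSpace (Y t)] :
    Flavor → Measure (((∀ t, X t) × (∀ t, Y t)) × ((∀ t, X t) × (∀ t, Y t))) → Prop
  | .plain => fun _ => True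
  | .causal => fun θ => IsCausalFor (coordσ2 X Y) (coordσ2 X Y) θ
  | .anticausal => fun θ => IsAnticausalFor (coordσ2 X Y) (coordσ2 X Y) θ
  | .bicausal => fun θ => IsCausalFor (coordσ2 X Y) (coordσ2 X Y) θ ∧
      IsAnticausalFor (coordσ2 X Y) (coordσ2 X Y) θ

/-- The set `Π_•(π, π̃)` of couplings of two measures on `X × Y`, with adaptedness understood
for `X × Y` as one path space. -/
def aCouplings2 {X Y : Fin N → Type*} [∀ t, MeasurableSpace (X t)] [∀ t, MeasurableSpace (Y t)]
    (b : Flavor) (π ρ : Measure ((∀ t, X t) × (∀ t, Y t))) :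
    Set (Measure (((∀ t, X t) × (∀ t, Y t)) × ((∀ t, X t) × (∀ t, Y t)))) :=
  {θ | IsCoupling π ρ θ ∧ IsAdapted2 b θ}

/-- `p`-th power transport cost `∫ d_X(x,x̃)^p + d_Y(y,ỹ)^p dθ` for couplings of couplings. -/
def lcost2 (p : ℝ) {A B : Type*} [MeasurableSpace A] [MeasurableSpace B]
    [PseudoEMetricSpace A] [PseudoEMetricSpace B]
    (θ : Measure ((A × B) × (A × B))) : ℝ≥0∞ :=
  ∫⁻ z, (edist z.1.1 z.2.1 ^ p + edist z.1.2 z.2.2 ^ p) ∂θ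

/-- The (adapted) Wasserstein distance `W_{p,•}(π, π̃)` between couplings, with cost
`d_X^p + d_Y^p` and `X × Y` regarded as one path space. -/
def W2 {X Y : Fin N → Type*} [∀ t, MeasurableSpace (X t)] [∀ t, MeasurableSpace (Y t)]
    [∀ t, PseudoEMetricSpace (X t)] [∀ t, PseudoEMetricSpace (Y t)]
    (p : ℝ) (b : Flavor) (π ρ : Measure ((∀ t, X t) × (∀ t, Y t))) : ℝ≥0∞ :=
  (⨅ θ : aCouplings2 b π ρ, lcost2 p θ.1) ^ (1 / p)

/- Relative entropy (Kullback-Leibler divergence): `D_KL(π, ρ) = ∫ log (dπ/dρ) dπ` if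
`π ≪ ρ` and the integral is defined, and `∞` otherwise. -/
open Classical in
def KL {Ω : Type*} [MeasurableSpace Ω] (π ρ : Measure Ω) : ℝ≥0∞ :=
  if π ≪ ρ ∧ Integrable (llr π ρ) π then ENNReal.ofReal (∫ ω, llr π ρ ω ∂π) else ⊤

/-- The transport value `V_•(μ, ν, c)`. -/
def V {X Y : Fin N → Type*} [∀ t, MeasurableSpace (X t)] [∀ t, MeasurableSpace (Y t)]
    (b : Flavor) (μ : Measure (∀ t, X t)) (ν : Measure (∀ t, Y t))
    (c : (∀ t, X t) × (∀ t, Y t) → ℝ) : ℝ :=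
  ⨅ π : aCouplings b μ ν, ∫ z, c z ∂π.1

/-- The entropic objective `∫ c dπ + ε D_KL(π, P)`, valued in `EReal`. -/
def entObj {Ω : Type*} [MeasurableSpace Ω] (c : Ω → ℝ) (ε : ℝ) (P : Measure Ω)
    (π : Measure Ω) : EReal :=
  ((∫ z, c z ∂π : ℝ) : EReal) + (ε : EReal) * ((KL π P : ℝ≥0∞) : EReal)

/-- The entropic transport value `E_•^ε(μ, ν, c)`, valued in `EReal`. -/
def EE {X Y : Fin N → Type*} [∀ t, MeasurableSpace (X t)] [∀ t, MeasurableSpace (Y t)]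
    (b : Flavor) (μ : Measure (∀ t, X t)) (ν : Measure (∀ t, Y t))
    (c : (∀ t, X t) × (∀ t, Y t) → ℝ) (ε : ℝ) : EReal :=
  ⨅ π : aCouplings b μ ν, entObj c ε (μ.prod ν) π.1

/-- The kernel `K(x, y) := K^μ(x) ⊗ K^ν(y)` used to build the shadow. -/
def shadowKernel {A A' B B' : Type*} [MeasurableSpace A] [MeasurableSpace A']
    [MeasurableSpace B] [MeasurableSpace B']
    (Kμ : Kernel A A') (Kν : Kernel B B') : Kernel (A × B) (A' × B') :=
  (Kμ.comap Prod.fst measurable_fst) ×ₖ (Kν.comap Prod.snd measurable_snd)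

/-- The `(K^μ, K^ν)`-shadow of `π`: the second marginal of `π ⊗ (K^μ ⊗ K^ν)`. -/
def shadow {A A' B B' : Type*} [MeasurableSpace A] [MeasurableSpace A']
    [MeasurableSpace B] [MeasurableSpace B']
    (π : Measure (A × B)) (Kμ : Kernel A A') (Kν : Kernel B B') : Measure (A' × B') :=
  (π ⊗ₘ (shadowKernel Kμ Kν)).map Prod.snd

/-- `μ` has a finite `p`-th moment. -/
def MemPp {A : Type*} [MeasurableSpace A] [PseudoEMetricSpace A] (p : ℝ) (μ : Measure A) :
    Prop :=
  ∀ x₀ : A, ∫⁻ x, edist x₀ x ^ p ∂μ ≠ ⊤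

/-- `c` has growth of order at most `p`. -/
def GrowthLE {A B : Type*} [PseudoEMetricSpace A] [PseudoEMetricSpace B]
    (p : ℝ) (c : A × B → ℝ) : Prop :=
  ∃ (x₀ : A) (y₀ : B) (M : ℝ), ∀ z : A × B,
    |c z| ≤ M * (1 + (edist x₀ z.1).toReal ^ p + (edist y₀ z.2).toReal ^ p)

/-- Weak convergence of a sequence of measures (testing against bounded continuous
functions). -/
def WeakTendsto {A : Type*} [MeasurableSpace A] [TopologicalSpace A]
    (πs : ℕ → Measure A) (π : Measure A) : Prop :=
  ∀ f : BoundedContinuousFunction A ℝ,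
    Tendsto (fun n => ∫ x, f x ∂(πs n)) atTop (𝓝 (∫ x, f x ∂π))

/-- A finitely supported (discrete) measure. -/
def FinitelySupported {A : Type*} [MeasurableSpace A] (μ : Measure A) : Prop :=
  ∃ s : Finset A, μ (↑s)ᶜ = 0


/-- `K` is a version of the conditional distribution of the random element `V` given the
sub-σ-algebra `m`, under the measure `ρ`. -/
def IsCondDistrib' {Ω E : Type*} {mΩ : MeasurableSpace Ω} [MeasurableSpace E]
    (ρ : @Measure Ω mΩ) (V : Ω → E) (m : MeasurableSpace Ω) (K : Ω → Measure E) : Prop :=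
  (∀ ω, IsProbabilityMeasure (K ω)) ∧
  (∀ A : Set E, MeasurableSet A → Measurable[m] (fun ω => (K ω A).toReal)) ∧
  (∀ A : Set E, MeasurableSet A →
    (ρ[(V ⁻¹' A).indicator (fun _ => (1 : ℝ)) | m]) =ᵐ[ρ] fun ω => (K ω A).toReal)

/-- `Kμ` is a family of disintegration kernels of `μ` on a path space: `Kμ t` is a version of
the conditional distribution of the `t`-th coordinate given the past before `t`. -/
def IsDisintegration {X : Fin N → Type*} [∀ t, MeasurableSpace (X t)]
    (μ : Measure (∀ t, X t)) (Kμ : ∀ t : Fin N, (∀ s, X s) → Measure (X t)) : Prop :=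
  ∀ t : Fin N, IsCondDistrib' μ (fun x => x t) (pastσ X (t : ℕ)) (Kμ t)

variable {X Y : Fin N → Type*} [∀ t, MeasurableSpace (X t)] [∀ t, MeasurableSpace (Y t)]

open Classical in
/-- Membership in the dual building block `A_{X,μ,t}` (relative to a fixed family `Kμ` of
disintegration kernels of `μ`): for `t = 1` the bounded measurable functions of `x₁`; for
`t ≥ 2` functions `a_t(x_{1:t}, y_{1:t-1}) - ∫ a_t(x_{1:t-1}, x̃_t, y_{1:t-1}) μ_t^{x_{1:t-1}}(dx̃_t)`
with `a_t` bounded measurable. (Here `τ` is the 0-based coordinate index, `τ = t - 1`.) -/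
def MemAX (Kμ : ∀ t : Fin N, (∀ s, X s) → Measure (X t)) (τ : Fin N)
    (f : (∀ t, X t) × (∀ t, Y t) → ℝ) : Prop :=
  if (τ : ℕ) = 0 then
    ∃ a : (∀ t, X t) × (∀ t, Y t) → ℝ,
      Measurable[(coordσ X τ).comap Prod.fst] a ∧ (∃ M, ∀ ω, |a ω| ≤ M) ∧ f = a
  else
    ∃ a : (∀ t, X t) × (∀ t, Y t) → ℝ,
      Measurable[((pastσ X (τ : ℕ) ⊔ coordσ X τ).comap Prod.fst) ⊔
        ((pastσ Y (τ : ℕ)).comap Prod.snd)] a ∧ (∃ M, ∀ ω, |a ω| ≤ M) ∧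
      f = fun ω => a ω - ∫ x', a (Function.update ω.1 τ x', ω.2) ∂(Kμ τ ω.1)

open Classical in
/-- Membership in the dual building block `A_{Y,ν,t}` (symmetric to `MemAX`). -/
def MemAY (Kν : ∀ t : Fin N, (∀ s, Y s) → Measure (Y t)) (τ : Fin N)
    (f : (∀ t, X t) × (∀ t, Y t) → ℝ) : Prop :=
  if (τ : ℕ) = 0 then
    ∃ a : (∀ t, X t) × (∀ t, Y t) → ℝ,
      Measurable[(coordσ Y τ).comap Prod.snd] a ∧ (∃ M, ∀ ω, |a ω| ≤ M) ∧ f = a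
  else
    ∃ a : (∀ t, X t) × (∀ t, Y t) → ℝ,
      Measurable[((pastσ X (τ : ℕ)).comap Prod.fst) ⊔
        ((pastσ Y (τ : ℕ) ⊔ coordσ Y τ).comap Prod.snd)] a ∧ (∃ M, ∀ ω, |a ω| ≤ M) ∧
      f = fun ω => a ω - ∫ y', a (ω.1, Function.update ω.2 τ y') ∂(Kν τ ω.2)

/-- The dual space `S_{X,μ}`: sums `∑_{t=1}^N f_t` with `f_t ∈ A_{X,μ,t}`. -/
def MemSXμ (Kμ : ∀ t : Fin N, (∀ s, X s) → Measure (X t))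
    (s : (∀ t, X t) × (∀ t, Y t) → ℝ) : Prop :=
  ∃ f : Fin N → ((∀ t, X t) × (∀ t, Y t) → ℝ),
    (∀ τ, MemAX Kμ τ (f τ)) ∧ s = fun ω => ∑ τ, f τ ω

/-- The dual space `S_{Y,ν}`: sums `∑_{t=1}^N g_t` with `g_t ∈ A_{Y,ν,t}`. -/
def MemSYν (Kν : ∀ t : Fin N, (∀ s, Y s) → Measure (Y t))
    (s : (∀ t, X t) × (∀ t, Y t) → ℝ) : Prop :=
  ∃ g : Fin N → ((∀ t, X t) × (∀ t, Y t) → ℝ),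
    (∀ τ, MemAY Kν τ (g τ)) ∧ s = fun ω => ∑ τ, g τ ω

/-- The space `S_X` of bounded measurable functions depending only on `x`. -/
def MemSX (s : (∀ t, X t) × (∀ t, Y t) → ℝ) : Prop :=
  ∃ g : (∀ t, X t) → ℝ, Measurable g ∧ (∃ M, ∀ x, |g x| ≤ M) ∧ s = fun ω => g ω.1

/-- The space `S_Y` of bounded measurable functions depending only on `y`. -/
def MemSY (s : (∀ t, X t) × (∀ t, Y t) → ℝ) : Prop :=
  ∃ g : (∀ t, Y t) → ℝ, Measurable g ∧ (∃ M, ∀ y, |g y| ≤ M) ∧ s = fun ω => g ω.2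

/-- The dual space `H_•`: `H = S_X ⊕ S_Y`, `H_c = S_{X,μ} ⊕ S_Y`, `H_{ac} = S_X ⊕ S_{Y,ν}`,
`H_{bc} = S_{X,μ} ⊕ S_{Y,ν}`. -/
def MemH (Kμ : ∀ t : Fin N, (∀ s, X s) → Measure (X t))
    (Kν : ∀ t : Fin N, (∀ s, Y s) → Measure (Y t)) :
    Flavor → ((∀ t, X t) × (∀ t, Y t) → ℝ) → Prop
  | .plain => fun h => ∃ sX sY, MemSX (X := X) (Y := Y) sX ∧ MemSY sY ∧
      h = fun ω => sX ω + sY ω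
  | .causal => fun h => ∃ sX sY, MemSXμ Kμ sX ∧ MemSY sY ∧ h = fun ω => sX ω + sY ω
  | .anticausal => fun h => ∃ sX sY, MemSX (X := X) (Y := Y) sX ∧ MemSYν Kν sY ∧
      h = fun ω => sX ω + sY ω
  | .bicausal => fun h => ∃ sX sY, MemSXμ Kμ sX ∧ MemSYν Kν sY ∧ h = fun ω => sX ω + sY ω

/-- The set `Π_c(μ, ∗)` of causal measures with first marginal `μ` and arbitrary second
marginal. -/
def causalFirst (μ : Measure (∀ t, X t)) : Set (Measure ((∀ t, X t) × (∀ t, Y t))) :=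
  {π | π.map Prod.fst = μ ∧ IsCausal π}

/-- The set `Π(∗, ν)` of couplings with arbitrary first marginal and second marginal `ν`. -/
def secondMarg (ν : Measure (∀ t, Y t)) : Set (Measure ((∀ t, X t) × (∀ t, Y t))) :=
  {π | π.map Prod.snd = ν}

/-- The set `Π_{ac}(∗, ν)` of anticausal measures with second marginal `ν`. -/
def anticausalSecond (ν : Measure (∀ t, Y t)) : Set (Measure ((∀ t, X t) × (∀ t, Y t))) :=
  {π | π.map Prod.snd = ν ∧ IsAnticausal π}

/-- The reference measure `P_c` with `dP_c/dP = exp(-c)/∫ exp(-c) dP`. -/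
def Pc {Ω : Type*} [MeasurableSpace Ω] (P : Measure Ω) (c : Ω → ℝ) : Measure Ω :=
  P.withDensity
    (fun ω => ENNReal.ofReal (Real.exp (-c ω)) / ∫⁻ ω', ENNReal.ofReal (Real.exp (-c ω')) ∂P)

/-- Sinkhorn's algorithm: `full 0 = π0`; `half k` is the `D_KL`-projection of `full k`
onto `Q1`, and `full (k+1)` is the `D_KL`-projection of `half k` onto `Q2`. -/
structure IsSinkhorn {Ω : Type*} [MeasurableSpace Ω] (Q1 Q2 : Set (Measure Ω))
    (π0 : Measure Ω) (full half : ℕ → Measure Ω) : Prop where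
  init : full 0 = π0
  half_mem : ∀ k, half k ∈ Q1
  half_opt : ∀ k, ∀ ρ ∈ Q1, KL (half k) (full k) ≤ KL ρ (full k)
  full_mem : ∀ k, full (k + 1) ∈ Q2
  full_opt : ∀ k, ∀ ρ ∈ Q2, KL (full (k + 1)) (half k) ≤ KL ρ (half k)

/-- The second projection set of Sinkhorn's algorithm: `Π(∗, ν)` for the causal problem and
`Π_{ac}(∗, ν)` for the bicausal problem. -/
def sinkQ2 (b : Flavor) (ν : Measure (∀ t, Y t)) : Set (Measure ((∀ t, X t) × (∀ t, Y t))) :=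
  match b with
  | .bicausal => anticausalSecond ν
  | _ => secondMarg ν

/-- The dual class of the second Sinkhorn potential: `S_Y` for the causal problem,
`S_{Y,ν}` for the bicausal problem. -/
def MemG (Kν : ∀ t : Fin N, (∀ s, Y s) → Measure (Y t)) :
    Flavor → ((∀ t, X t) × (∀ t, Y t) → ℝ) → Prop
  | .bicausal => fun g => MemSYν Kν g
  | _ => fun g => MemSY g

/-- Real-valued entropic transport value (`ε = 1`), the infimum being taken over couplings
with finite relative entropy. -/
def Efin (b : Flavor) (μ : Measure (∀ t, X t)) (ν : Measure (∀ t, Y t))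
    (c : (∀ t, X t) × (∀ t, Y t) → ℝ) : ℝ :=
  ⨅ π : {π : Measure ((∀ t, X t) × (∀ t, Y t)) //
      π ∈ aCouplings b μ ν ∧ KL π (μ.prod ν) ≠ ⊤},
    (∫ z, c z ∂π.1 + (KL π.1 (μ.prod ν)).toReal)

/-- Total variation distance `‖μ − ν‖_TV = sup_B μ(B) − ν(B)`. -/
def TV {A : Type*} [MeasurableSpace A] (μ ν : Measure A) : ℝ≥0∞ :=
  ⨆ B : {B : Set A // MeasurableSet B}, (μ B.1 - ν B.1)

/-- Adapted variation `‖μ − ν‖_AV = inf_{π ∈ Π_bc(μ, ν)} π({x ≠ x̃})`. -/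
def AV {N : ℕ} {X : Fin N → Type*} [∀ t, MeasurableSpace (X t)]
    (μ ν : Measure (∀ t, X t)) : ℝ≥0∞ :=
  ⨅ π : aCouplings .bicausal μ ν, π.1 {z | z.1 ≠ z.2}

/-- Two Markov kernels admit a measurable family of couplings whose mass off the diagonal is
controlled by the difference of the kernels on a single jointly measurable set. -/
lemma exists_coupling_kernel {E F : Type*} [MeasurableSpace E] [MeasurableSpace F]
    [StandardBorelSpace F]
    (K K' : Kernel E F) [IsMarkovKernel K] [IsMarkovKernel K'] :
    ∃ (J : Kernel E (F × F)) (B : Set (E × F)), MeasurableSet B ∧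
      (∀ x, (J x).map Prod.fst = K x) ∧ (∀ x, (J x).map Prod.snd = K' x) ∧
      ∀ x, J x {w | w.1 ≠ w.2} + K' x (Prod.mk x ⁻¹' B) ≤ K x (Prod.mk x ⁻¹' B) := by
  set f := K.rnDeriv (K + K')
  set g := K'.rnDeriv (K + K')
  have hf : Measurable (Function.uncurry f) := K.measurable_rnDeriv _
  have hg : Measurable (Function.uncurry g) := K'.measurable_rnDeriv _
  have hfx (x : E) : Measurable (f x) := hf.comp measurable_prodMk_left
  have hgx (x : E) : Measurable (g x) := hg.comp measurable_prodMk_left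
  have hac (x : E) : K x ≪ (K + K') x := by
    rw [add_apply]; exact Measure.AbsolutelyContinuous.rfl.add_right _
  have hac' (x : E) : K' x ≪ (K + K') x := by
    rw [add_apply, add_comm]; exact Measure.AbsolutelyContinuous.rfl.add_right _
  have hK (x : E) : ((K + K') x).withDensity (f x) = K x := by
    rw [← Kernel.withDensity_apply _ hf]; exact Kernel.withDensity_rnDeriv_eq (hac x)
  have hK' (x : E) : ((K + K') x).withDensity (g x) = K' x := by
    rw [← Kernel.withDensity_apply _ hg]; exact Kernel.withDensity_rnDeriv_eq (hac' x)
  have hm1 : Measurable (Function.uncurry fun x u => min (f x u) (g x u)) := hf.min hg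
  have hm2 : Measurable (Function.uncurry fun x u => f x u - g x u) := hf.sub hg
  have hm3 : Measurable (Function.uncurry fun x u => g x u - f x u) := hg.sub hf
  set M := (K + K').withDensity fun x u => min (f x u) (g x u)
  set R := (K + K').withDensity fun x u => f x u - g x u
  set R' := (K + K').withDensity fun x u => g x u - f x u
  have hM (x : E) : M x = ((K + K') x).withDensity fun u => min (f x u) (g x u) :=
    Kernel.withDensity_apply _ hm1 x
  have hR (x : E) : R x = ((K + K') x).withDensity fun u => f x u - g x u :=
    Kernel.withDensity_apply _ hm2 x
  have hR' (x : E) : R' x = ((K + K') x).withDensity fun u => g x u - f x u :=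
    Kernel.withDensity_apply _ hm3 x
  have hMR (x : E) : M x + R x = K x := by
    rw [hM, hR, ← hK, ← withDensity_add_left ((hfx x).min (hgx x))]
    congr 1; ext u
    rcases le_total (f x u) (g x u) with h | h
    · simp [h, tsub_eq_zero_of_le]
    · simp [h, add_tsub_cancel_of_le]
  have hMR' (x : E) : M x + R' x = K' x := by
    rw [hM, hR', ← hK', ← withDensity_add_left ((hfx x).min (hgx x))]
    congr 1; ext u
    rcases le_total (f x u) (g x u) with h | h
    · simp [h, add_tsub_cancel_of_le]
    · simp [h, tsub_eq_zero_of_le]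
  have hMR1 (x : E) : M x univ + R x univ = 1 := by
    rw [← Measure.add_apply, hMR, measure_univ]
  have hMR1' (x : E) : M x univ + R' x univ = 1 := by
    rw [← Measure.add_apply, hMR', measure_univ]
  have : IsFiniteKernel M := ⟨1, by simp, fun x => by rw [← hMR1 x]; exact le_self_add⟩
  have : IsFiniteKernel R := ⟨1, by simp, fun x => by rw [← hMR1 x]; exact le_add_self⟩
  have : IsFiniteKernel R' := ⟨1, by simp, fun x => by rw [← hMR1' x]; exact le_add_self⟩
  have hα (x : E) : R x univ = R' x univ :=
    (ENNReal.add_right_inj (measure_ne_top (M x) univ)).1 ((hMR1 x).trans (hMR1' x).symm)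
  have hαm : Measurable (Function.uncurry fun (x : E) (_ : F × F) => (R x univ)⁻¹) :=
    ((R.measurable_coe MeasurableSet.univ).comp measurable_fst).inv
  set P := (R ×ₖ R').withDensity fun x _ => (R x univ)⁻¹
  have hP (x : E) : P x = (R x univ)⁻¹ • ((R x).prod (R' x)) := by
    rw [Kernel.withDensity_apply _ hαm, Kernel.prod_apply, withDensity_const]
  have hP1 (x : E) : (P x).map Prod.fst = R x := by
    rw [hP, Measure.map_smul, Measure.map_fst_prod, ← hα, smul_smul]
    by_cases h : R x univ = 0
    · simp [Measure.measure_univ_eq_zero.1 h]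
    · rw [ENNReal.inv_mul_cancel h (measure_ne_top _ _), one_smul]
  have hP2 (x : E) : (P x).map Prod.snd = R' x := by
    rw [hP, Measure.map_smul, Measure.map_snd_prod, smul_smul]
    by_cases h : R x univ = 0
    · rw [hα] at h; simp [Measure.measure_univ_eq_zero.1 h]
    · rw [ENNReal.inv_mul_cancel h (measure_ne_top _ _), one_smul]
  have hd : Measurable fun u : F => (u, u) := measurable_id.prodMk measurable_id
  have hne : MeasurableSet {w : F × F | w.1 ≠ w.2} :=
    (measurableSet_eq_fun measurable_fst measurable_snd).compl
  have hB : MeasurableSet {q : E × F | g q.1 q.2 < f q.1 q.2} := measurableSet_lt hg hf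
  refine ⟨M.map (fun u => (u, u)) + P, {q | g q.1 q.2 < f q.1 q.2}, hB, fun x => ?_, fun x => ?_,
    fun x => ?_⟩
  · rw [add_apply, Measure.map_add _ _ measurable_fst, hP1, Kernel.map_apply _ hd,
      Measure.map_map measurable_fst hd, ← hMR]
    congr 1; exact Measure.map_id
  · rw [add_apply, Measure.map_add _ _ measurable_snd, hP2, Kernel.map_apply _ hd,
      Measure.map_map measurable_snd hd, ← hMR']
    congr 1; exact Measure.map_id
  · have hBx : MeasurableSet (Prod.mk x ⁻¹' {q : E × F | g q.1 q.2 < f q.1 q.2}) :=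
      measurable_prodMk_left hB
    have h1 : P x {w | w.1 ≠ w.2} ≤ R x univ :=
      calc P x {w | w.1 ≠ w.2} ≤ P x (Prod.fst ⁻¹' univ) := measure_mono (by simp)
        _ = R x univ := by rw [← hP1 x, Measure.map_apply measurable_fst MeasurableSet.univ]
    have h2 : R x univ = R x (Prod.mk x ⁻¹' {q : E × F | g q.1 q.2 < f q.1 q.2}) := by
      refine (measure_eq_measure_of_null_sdiff (subset_univ _) ?_).symm
      rw [hR, withDensity_apply _ (MeasurableSet.univ.diff hBx),
        setLIntegral_eq_zero (MeasurableSet.univ.diff hBx)]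
      intro u hu
      exact tsub_eq_zero_of_le (not_lt.1 hu.2)
    have h3 : R' x (Prod.mk x ⁻¹' {q : E × F | g q.1 q.2 < f q.1 q.2}) = 0 := by
      rw [hR', withDensity_apply _ hBx, setLIntegral_eq_zero hBx]
      intro u hu
      exact tsub_eq_zero_of_le (le_of_lt (a := g x u) hu)
    rw [add_apply, Measure.add_apply, Kernel.map_apply' _ hd _ hne]
    have h4 : M x ((fun u => (u, u)) ⁻¹' {w : F × F | w.1 ≠ w.2}) = 0 := by simp
    rw [h4, zero_add, ← hMR', ← hMR, Measure.add_apply, Measure.add_apply, h3, add_zero,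
      add_comm, ← h2]
    gcongr

lemma map_compProd_of_map_eq {P P' W W' : Type*} [MeasurableSpace P] [MeasurableSpace P']
    [MeasurableSpace W] [MeasurableSpace W'] (π : Measure P) [SFinite π]
    (L : Kernel P W) [IsMarkovKernel L] (K : Kernel P' W') [IsMarkovKernel K]
    {a : P → P'} {b : W → W'} (ha : Measurable a) (hb : Measurable b)
    (h : ∀ p, (L p).map b = K (a p)) :
    (π ⊗ₘ L).map (Prod.map a b) = π.map a ⊗ₘ K := by
  ext s hs
  rw [Measure.map_apply (ha.prodMap hb) hs, Measure.compProd_apply (ha.prodMap hb hs),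
    Measure.compProd_apply hs, lintegral_map (Kernel.measurable_kernel_prodMk_left hs) ha]
  refine lintegral_congr fun p => ?_
  rw [← h, Measure.map_apply hb (measurable_prodMk_left hs)]
  rfl

/-- Conditional independence of `m₁` and `m₂` given `m₃`, phrased through `m₃`-measurable
conditional probabilities of the events of `m₁` that integrate correctly over `m₂ ∩ m₃`. -/
def HasCondProb {Ω : Type*} {mΩ : MeasurableSpace Ω} (m₁ m₂ m₃ : MeasurableSpace Ω)
    (π : @Measure Ω mΩ) : Prop :=
  ∀ A, MeasurableSet[m₁] A → ∃ g : Ω → ℝ≥0∞, Measurable[m₃] g ∧ (∀ z, g z ≤ 1) ∧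
    ∀ B C, MeasurableSet[m₂] B → MeasurableSet[m₃] C → π (A ∩ (B ∩ C)) = ∫⁻ z in B ∩ C, g z ∂π

lemma HasCondProb.comap {Ω Ω' : Type*} {mΩ : MeasurableSpace Ω} {m₁ m₂ m₃ : MeasurableSpace Ω'}
    {mΩ' : MeasurableSpace Ω'} (h₁ : m₁ ≤ mΩ') (h₂ : m₂ ≤ mΩ') (h₃ : m₃ ≤ mΩ')
    {ρ : Measure Ω} {p : Ω → Ω'} (hp : Measurable p) (h : HasCondProb m₁ m₂ m₃ (ρ.map p)) :
    HasCondProb (m₁.comap p) (m₂.comap p) (m₃.comap p) ρ := by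
  rintro _ ⟨A, hA, rfl⟩
  obtain ⟨g, hg, hg1, hbal⟩ := h A hA
  refine ⟨g ∘ p, hg.comp (comap_measurable p), fun z => hg1 _, ?_⟩
  rintro _ _ ⟨B, hB, rfl⟩ ⟨C, hC, rfl⟩
  have hBC := (h₂ _ hB).inter (h₃ _ hC)
  have := hbal B C hB hC
  rwa [Measure.map_apply hp ((h₁ _ hA).inter hBC),
    setLIntegral_map hBC (hg.mono h₃ le_rfl) hp] at this

lemma HasCondProb.condIndepσ {Ω : Type*} {m₁ m₂ m₃ : MeasurableSpace Ω} {mΩ : MeasurableSpace Ω}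
    (h₁ : m₁ ≤ mΩ) (h₂ : m₂ ≤ mΩ) (h₃ : m₃ ≤ mΩ) {π : Measure Ω} [IsProbabilityMeasure π]
    (h : HasCondProb m₁ m₂ m₃ π) (A B : Set Ω) (hA : MeasurableSet[m₁] A)
    (hB : MeasurableSet[m₂] B) :
    (π[(A ∩ B).indicator (fun _ => (1 : ℝ)) | m₃]) =ᵐ[π]
      (π[A.indicator (fun _ => (1 : ℝ)) | m₃]) * (π[B.indicator (fun _ => (1 : ℝ)) | m₃]) := by
  obtain ⟨g, hg, hg1, hbal⟩ := h A hA
  have hgm : Measurable g := hg.mono h₃ le_rfl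
  have hgr : Measurable[m₃] fun z => (g z).toReal := hg.ennreal_toReal
  have hgrm : Measurable fun z => (g z).toReal := hgm.ennreal_toReal
  have hbound (z : Ω) : ‖(g z).toReal‖ ≤ 1 := by
    rw [Real.norm_of_nonneg ENNReal.toReal_nonneg]
    exact ENNReal.toReal_le_of_le_ofReal zero_le_one (by simpa using hg1 z)
  have hgi : Integrable (fun z => (g z).toReal) π :=
    Integrable.of_bound hgrm.aestronglyMeasurable 1 (ae_of_all _ hbound)
  have hind {S : Set Ω} (hS : MeasurableSet S) :
      Integrable (S.indicator fun _ => (1 : ℝ)) π := (integrable_const 1).indicator hS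
  have key (B : Set Ω) (hB : MeasurableSet[m₂] B) :
      (π[(A ∩ B).indicator (fun _ => (1 : ℝ)) | m₃]) =ᵐ[π]
        (fun z => (g z).toReal) * (π[B.indicator (fun _ => (1 : ℝ)) | m₃]) := by
    have hBm := h₂ _ hB
    have hmul : (fun z => (g z).toReal) * (B.indicator fun _ => (1 : ℝ))
        = B.indicator fun z => (g z).toReal := by
      ext z; by_cases hz : z ∈ B <;> simp [hz]
    have hmi : Integrable (B.indicator fun z => (g z).toReal) π := hgi.indicator hBm
    have e1 := condExp_mul_of_stronglyMeasurable_left (m := m₃) (μ := π)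
      hgr.stronglyMeasurable (hmul ▸ hmi) (hind hBm)
    refine EventuallyEq.trans ?_ e1
    rw [hmul]
    refine (ae_eq_condExp_of_forall_setIntegral_eq h₃ hmi
      (fun _ _ _ => integrable_condExp.integrableOn) (fun C hC _ => ?_)
      stronglyMeasurable_condExp.aestronglyMeasurable)
    have hABm := (h₁ _ hA).inter hBm
    rw [setIntegral_condExp h₃ (hind hABm) hC, setIntegral_indicator hABm,
      setIntegral_indicator hBm, setIntegral_one_eq_measureReal, inter_comm C B,
      integral_toReal hgm.aemeasurable (ae_of_all _ fun z => (hg1 z).trans_lt ENNReal.one_lt_top),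
      ← hbal B C hB hC, measureReal_def]
    congr 2; ext z; simp only [mem_inter_iff]; tauto
  have e2 := key univ MeasurableSet.univ
  rw [inter_univ, indicator_univ, condExp_const h₃ (1 : ℝ)] at e2
  filter_upwards [key B hB, e2] with z hz hz2
  rw [hz, Pi.mul_apply, Pi.mul_apply, hz2]
  simp

/-- Causality phrased through conditional probabilities, as in `HasCondProb`. -/
def HasCausalCondProb {n : ℕ} {X Y : Fin n → Type*} [∀ t, MeasurableSpace (X t)]
    [∀ t, MeasurableSpace (Y t)] (π : Measure ((∀ t, X t) × (∀ t, Y t))) : Prop :=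
  ∀ t : Fin n, HasCondProb ((coordσ X t).comap Prod.fst)
    ((pastσOf (coordσ Y) (t : ℕ)).comap Prod.snd) ((pastσOf (coordσ X) (t : ℕ)).comap Prod.fst) π

lemma coordσ_le {n : ℕ} (X : Fin n → Type*) [∀ t, MeasurableSpace (X t)] (t : Fin n) :
    coordσ X t ≤ MeasurableSpace.pi :=
  (measurable_pi_apply t).comap_le

lemma pastσOf_coordσ_le {n : ℕ} (X : Fin n → Type*) [∀ t, MeasurableSpace (X t)] (k : ℕ) :
    pastσOf (coordσ X) k ≤ MeasurableSpace.pi :=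
  iSup₂_le fun t _ => coordσ_le X t

lemma pastσOf_coordσ_self {n : ℕ} (X : Fin n → Type*) [∀ t, MeasurableSpace (X t)] :
    pastσOf (coordσ X) n = MeasurableSpace.pi := by
  simp [pastσOf, coordσ, MeasurableSpace.pi]

lemma measurable_init {n : ℕ} (X : Fin (n + 1) → Type*) [∀ t, MeasurableSpace (X t)] :
    Measurable (Fin.init : (∀ t, X t) → ∀ t : Fin n, X t.castSucc) :=
  measurable_pi_lambda _ fun t => measurable_pi_apply t.castSucc

lemma measurable_snoc {n : ℕ} (X : Fin (n + 1) → Type*) [∀ t, MeasurableSpace (X t)] :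
    Measurable fun q : (∀ t : Fin n, X t.castSucc) × X (Fin.last n) =>
      (Fin.snoc q.1 q.2 : ∀ t, X t) := by
  refine measurable_pi_lambda _ fun t => ?_
  induction t using Fin.lastCases with
  | last => simpa using measurable_snd
  | cast t => simpa [Function.comp_def] using (measurable_pi_apply t).comp measurable_fst

lemma coordσ_castSucc {n : ℕ} (X : Fin (n + 1) → Type*) [∀ t, MeasurableSpace (X t)]
    (t : Fin n) :
    coordσ X t.castSucc = (coordσ (fun i : Fin n => X i.castSucc) t).comap Fin.init := by
  rw [coordσ, coordσ, MeasurableSpace.comap_comp]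
  rfl

lemma pastσOf_coordσ_eq_comap_init {n : ℕ} (X : Fin (n + 1) → Type*)
    [∀ t, MeasurableSpace (X t)] {k : ℕ} (hk : k ≤ n) :
    pastσOf (coordσ X) k
      = (pastσOf (coordσ fun i : Fin n => X i.castSucc) k).comap Fin.init := by
  simp only [pastσOf, MeasurableSpace.comap_iSup, ← coordσ_castSucc]
  refine le_antisymm (iSup₂_le fun s hs => ?_) (iSup₂_le fun s hs => ?_)
  · exact le_iSup₂_of_le (s.castLT (hs.trans_le hk)) hs le_rfl
  · exact le_iSup₂_of_le s.castSucc hs le_rfl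

/-- A measure is causal if its restriction to the first `n` time steps is causal and the last
coordinate of the first path is drawn from a kernel depending only on the past of that path. -/
lemma HasCausalCondProb.of_last {n : ℕ} {X Y : Fin (n + 1) → Type*}
    [∀ t, MeasurableSpace (X t)] [∀ t, MeasurableSpace (Y t)]
    {ρ : Measure ((∀ t, X t) × (∀ t, Y t))} [IsProbabilityMeasure ρ]
    {π : Measure ((∀ t : Fin n, X t.castSucc) × (∀ t : Fin n, Y t.castSucc))}
    (hρ : ρ.map (Prod.map Fin.init Fin.init) = π) (hπ : HasCausalCondProb π)
    (K : Kernel (∀ t : Fin n, X t.castSucc) (X (Fin.last n))) [IsMarkovKernel K]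
    (hK : ρ.map (fun z => (Prod.map Fin.init Fin.init z, z.1 (Fin.last n)))
      = π ⊗ₘ K.comap Prod.fst measurable_fst) :
    HasCausalCondProb ρ := by
  have hp := (measurable_init X).prodMap (measurable_init Y)
  have : IsProbabilityMeasure π := hρ ▸ Measure.isProbabilityMeasure_map hp.aemeasurable
  intro t
  induction t using Fin.lastCases with
  | cast t =>
    have h := HasCondProb.comap
      (((measurable_fst.mono le_rfl (coordσ_le _ t))).comap_le)
      ((measurable_snd.mono le_rfl (pastσOf_coordσ_le _ _)).comap_le)
      ((measurable_fst.mono le_rfl (pastσOf_coordσ_le _ _)).comap_le) hp (hρ.symm ▸ hπ t)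
    simp only [MeasurableSpace.comap_comp] at h
    simp only [Fin.val_castSucc, coordσ_castSucc, pastσOf_coordσ_eq_comap_init _ t.isLt.le,
      MeasurableSpace.comap_comp]
    exact h
  | last =>
    simp only [Fin.val_last, pastσOf_coordσ_eq_comap_init _ le_rfl,
      pastσOf_coordσ_self fun i : Fin n => X i.castSucc,
      pastσOf_coordσ_self fun i : Fin n => Y i.castSucc, coordσ, MeasurableSpace.comap_comp]
    rintro _ ⟨A, hA, rfl⟩
    have hKA : Measurable fun x => K x A := K.measurable_coe hA
    refine ⟨fun z => K (Fin.init z.1) A, hKA.comp (comap_measurable _), fun z => prob_le_one, ?_⟩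
    rintro _ _ ⟨B, hB, rfl⟩ ⟨C, hC, rfl⟩
    have h := congrArg (fun m => m ((C ×ˢ B) ×ˢ A)) hK
    have hq : Measurable fun z : (∀ t, X t) × (∀ t, Y t) =>
        ((Prod.map Fin.init Fin.init z :
          (∀ t : Fin n, X t.castSucc) × (∀ t : Fin n, Y t.castSucc)), z.1 (Fin.last n)) :=
      hp.prodMk ((measurable_pi_apply _).comp measurable_fst)
    rw [Measure.map_apply hq ((hC.prod hB).prod hA), Measure.compProd_apply_prod (hC.prod hB) hA, ← hρ,
      setLIntegral_map (hC.prod hB) (Kernel.measurable_coe _ hA) hp] at h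
    convert h using 2
    · ext z; simp; tauto
    · congr 1; ext z; simp; tauto
    · rfl

lemma HasCausalCondProb.isCausal {n : ℕ} {X Y : Fin n → Type*} [∀ t, MeasurableSpace (X t)]
    [∀ t, MeasurableSpace (Y t)] {π : Measure ((∀ t, X t) × (∀ t, Y t))}
    [IsProbabilityMeasure π] (h : HasCausalCondProb π) : IsCausal π := fun t A B hA hB =>
  (h t).condIndepσ (((measurable_fst.mono le_rfl (coordσ_le _ t))).comap_le)
    ((measurable_snd.mono le_rfl (pastσOf_coordσ_le _ _)).comap_le)
    ((measurable_fst.mono le_rfl (pastσOf_coordσ_le _ _)).comap_le) A B hA hB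

lemma TV_map_le {A B : Type*} [MeasurableSpace A] [MeasurableSpace B] (μ ν : Measure A)
    {f : A → B} (hf : Measurable f) : TV (μ.map f) (ν.map f) ≤ TV μ ν := by
  refine iSup_le fun S => ?_
  rw [Measure.map_apply hf S.2, Measure.map_apply hf S.2]
  exact le_iSup (fun B : {B : Set A // MeasurableSet B} => μ B.1 - ν B.1) ⟨_, hf S.2⟩

lemma measure_le_add_TV {A : Type*} [MeasurableSpace A] (μ ν : Measure A) {S : Set A}
    (hS : MeasurableSet S) : μ S ≤ ν S + TV μ ν :=
  tsub_le_iff_left.1 (le_iSup (fun B : {B : Set A // MeasurableSet B} => μ B.1 - ν B.1) ⟨S, hS⟩)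

/-- Extending a coupling of the first marginals by a coupling kernel of the disintegrations
that is efficient on the diagonal. -/
lemma exists_extension {E F : Type*} [MeasurableSpace E] [StandardBorelSpace E]
    [MeasurableSpace F] [StandardBorelSpace F] (π : Measure (E × E)) [IsProbabilityMeasure π]
    (K K' : Kernel E F) [IsMarkovKernel K] [IsMarkovKernel K'] :
    ∃ L : Kernel (E × E) (F × F), IsMarkovKernel L ∧
      (∀ p, (L p).map Prod.fst = K p.1) ∧ (∀ p, (L p).map Prod.snd = K' p.2) ∧
      (π ⊗ₘ L) {q | q.1.1 ≠ q.1.2 ∨ q.2.1 ≠ q.2.2} ≤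
        2 * π {p | p.1 ≠ p.2} + TV (π.map Prod.fst ⊗ₘ K) (π.map Prod.snd ⊗ₘ K') := by
  obtain ⟨J, B, hB, hJ1, hJ2, hJ⟩ := exists_coupling_kernel K K'
  have : IsMarkovKernel J := ⟨fun x => ⟨by
    have := congrArg (fun m => m univ) (hJ1 x)
    simpa [Measure.map_apply measurable_fst MeasurableSet.univ] using this⟩⟩
  have hD : MeasurableSet {p : E × E | p.1 = p.2} :=
    measurableSet_eq_fun measurable_fst measurable_snd
  have hne : MeasurableSet {w : F × F | w.1 ≠ w.2} :=
    (measurableSet_eq_fun measurable_fst measurable_snd).compl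
  classical
  set L : Kernel (E × E) (F × F) := Kernel.piecewise hD (J.comap Prod.fst measurable_fst)
    (K.comap Prod.fst measurable_fst ×ₖ K'.comap Prod.snd measurable_snd) with hL
  have hLD (p : E × E) (hp : p.1 = p.2) : L p = J p.1 := by
    simp [hL, Kernel.piecewise_apply, hp]
  have hLD' (p : E × E) (hp : p.1 ≠ p.2) : L p = (K p.1).prod (K' p.2) := by
    simp [hL, Kernel.piecewise_apply, hp, Kernel.prod_apply]
  have hLM : IsMarkovKernel L := by rw [hL]; infer_instance
  refine ⟨L, hLM, fun p => ?_, fun p => ?_, ?_⟩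
  · by_cases hp : p.1 = p.2
    · rw [hLD p hp, hJ1]
    · rw [hLD' p hp, Measure.map_fst_prod, measure_univ, one_smul]
  · by_cases hp : p.1 = p.2
    · rw [hLD p hp, hJ2, hp]
    · rw [hLD' p hp, Measure.map_snd_prod, measure_univ, one_smul]
  set D := {p : E × E | p.1 = p.2}
  have hDc : {p : E × E | p.1 ≠ p.2} = Dᶜ := rfl
  have hmK : Measurable fun x => K x (Prod.mk x ⁻¹' B) := Kernel.measurable_kernel_prodMk_left hB
  have hmK' : Measurable fun x => K' x (Prod.mk x ⁻¹' B) :=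
    Kernel.measurable_kernel_prodMk_left hB
  have hsplit : (π ⊗ₘ L) {q | q.1.1 ≠ q.1.2 ∨ q.2.1 ≠ q.2.2}
      ≤ π Dᶜ + ∫⁻ p in D, J p.1 {w | w.1 ≠ w.2} ∂π := by
    have hsub : {q : (E × E) × (F × F) | q.1.1 ≠ q.1.2 ∨ q.2.1 ≠ q.2.2}
        ⊆ (Dᶜ ×ˢ univ) ∪ (D ×ˢ {w | w.1 ≠ w.2}) := by
      rintro ⟨p, w⟩ h
      by_cases hp : p ∈ D
      · exact Or.inr ⟨hp, h.resolve_left fun h => h hp⟩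
      · exact Or.inl ⟨hp, trivial⟩
    refine (measure_mono hsub).trans ((measure_union_le _ _).trans ?_)
    rw [Measure.compProd_apply_prod hD.compl MeasurableSet.univ,
      Measure.compProd_apply_prod hD hne]
    refine add_le_add (by simp) (le_of_eq (setLIntegral_congr_fun hD fun p hp => ?_))
    simp only [hLD p hp]
  set T := TV (π.map Prod.fst ⊗ₘ K) (π.map Prod.snd ⊗ₘ K')
  have h1 : (∫⁻ p in D, J p.1 {w | w.1 ≠ w.2} ∂π) + ∫⁻ p in D, K' p.2 (Prod.mk p.2 ⁻¹' B) ∂π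
      ≤ (π Dᶜ + T) + ∫⁻ p in D, K' p.2 (Prod.mk p.2 ⁻¹' B) ∂π :=
    calc (∫⁻ p in D, J p.1 {w | w.1 ≠ w.2} ∂π) + ∫⁻ p in D, K' p.2 (Prod.mk p.2 ⁻¹' B) ∂π
      _ = ∫⁻ p in D, (J p.1 {w | w.1 ≠ w.2} + K' p.2 (Prod.mk p.2 ⁻¹' B)) ∂π :=
        (lintegral_add_right _ (hmK'.comp measurable_snd)).symm
      _ ≤ ∫⁻ p in D, K p.1 (Prod.mk p.1 ⁻¹' B) ∂π := by
        refine setLIntegral_mono (hmK.comp measurable_fst) fun p hp => ?_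
        rw [← show p.1 = p.2 from hp]
        exact hJ p.1
      _ ≤ ∫⁻ p, K p.1 (Prod.mk p.1 ⁻¹' B) ∂π := setLIntegral_le_lintegral _ _
      _ = (π.map Prod.fst ⊗ₘ K) B := by
        rw [Measure.compProd_apply hB, lintegral_map hmK measurable_fst]
      _ ≤ (π.map Prod.snd ⊗ₘ K') B + T := measure_le_add_TV _ _ hB
      _ = (∫⁻ p in D, K' p.2 (Prod.mk p.2 ⁻¹' B) ∂π)
          + (∫⁻ p in Dᶜ, K' p.2 (Prod.mk p.2 ⁻¹' B) ∂π) + T := by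
        rw [Measure.compProd_apply hB, lintegral_map hmK' measurable_snd,
          lintegral_add_compl _ hD]
      _ ≤ (∫⁻ p in D, K' p.2 (Prod.mk p.2 ⁻¹' B) ∂π) + (∫⁻ _ in Dᶜ, 1 ∂π) + T := by
        gcongr; exact prob_le_one
      _ = (π Dᶜ + T) + ∫⁻ p in D, K' p.2 (Prod.mk p.2 ⁻¹' B) ∂π := by
        rw [setLIntegral_one]; ring
  have hfin : ∫⁻ p in D, K' p.2 (Prod.mk p.2 ⁻¹' B) ∂π ≠ ⊤ :=
    ((lintegral_mono fun p => prob_le_one).trans_lt (by simp)).ne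
  have h2 := (ENNReal.add_le_add_iff_right hfin).1 h1
  calc _ ≤ π Dᶜ + (π Dᶜ + T) := hsplit.trans (by gcongr)
    _ = 2 * π {p | p.1 ≠ p.2} + T := by rw [hDc]; ring

theorem exists_bicausal_coupling {n : ℕ} (X : Fin n → Type*) [∀ t, MeasurableSpace (X t)]
    [∀ t, StandardBorelSpace (X t)] (μ μ' : Measure (∀ t, X t))
    [IsProbabilityMeasure μ] [IsProbabilityMeasure μ'] :
    ∃ π : Measure ((∀ t, X t) × (∀ t, X t)), IsProbabilityMeasure π ∧ IsCoupling μ μ' π ∧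
      HasCausalCondProb π ∧ HasCausalCondProb (π.map Prod.swap) ∧
      π {z | z.1 ≠ z.2} ≤ (2 ^ n - 1) * TV μ μ' := by
  induction n with
  | zero =>
    refine ⟨μ.prod μ', inferInstance, ⟨by simp, by simp⟩, fun t => t.elim0, fun t => t.elim0, ?_⟩
    have : {z : (∀ t, X t) × (∀ t, X t) | z.1 ≠ z.2} = ∅ := by
      ext z; simpa using Subsingleton.elim z.1 z.2
    simp [this]
  | succ n ih =>
    obtain ⟨x₀⟩ : Nonempty (∀ t, X t) := nonempty_of_isProbabilityMeasure μ
    have : Nonempty (X (Fin.last n)) := ⟨x₀ _⟩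
    have hi := measurable_init X
    have hs := measurable_snoc X
    have he : Measurable fun x : ∀ t, X t => (Fin.init x, x (Fin.last n)) :=
      hi.prodMk (measurable_pi_apply _)
    have hdis (ν : Measure (∀ t, X t)) [IsProbabilityMeasure ν] :
        ν.map Fin.init ⊗ₘ (ν.map fun x => (Fin.init x, x (Fin.last n))).condKernel
          = ν.map fun x => (Fin.init x, x (Fin.last n)) := by
      conv_rhs => rw [← (ν.map fun x => (Fin.init x, x (Fin.last n))).disintegrate
        (ν.map fun x => (Fin.init x, x (Fin.last n))).condKernel]
      rw [Measure.fst, Measure.map_map measurable_fst he]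
      rfl
    have hsnoc (ν : Measure (∀ t, X t)) :
        (ν.map fun x => (Fin.init x, x (Fin.last n))).map
          (fun q => (Fin.snoc q.1 q.2 : ∀ t, X t)) = ν := by
      rw [Measure.map_map hs he]
      convert Measure.map_id
      ext x : 1
      exact Fin.snoc_init_self x
    have := Measure.isProbabilityMeasure_map (μ := μ) hi.aemeasurable
    have := Measure.isProbabilityMeasure_map (μ := μ') hi.aemeasurable
    have := Measure.isProbabilityMeasure_map (μ := μ) he.aemeasurable
    have := Measure.isProbabilityMeasure_map (μ := μ') he.aemeasurable
    obtain ⟨π, hπ, ⟨hπ1, hπ2⟩, hc, hc', hb⟩ :=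
      ih (fun i : Fin n => X i.castSucc) (μ.map Fin.init) (μ'.map Fin.init)
    set K := (μ.map fun x => (Fin.init x, x (Fin.last n))).condKernel
    set K' := (μ'.map fun x => (Fin.init x, x (Fin.last n))).condKernel
    obtain ⟨L, hL, hL1, hL2, hLb⟩ := exists_extension π K K'
    have hr : Measurable fun q : ((∀ t : Fin n, X t.castSucc) × (∀ t : Fin n, X t.castSucc)) ×
        (X (Fin.last n) × X (Fin.last n)) =>
        ((Fin.snoc q.1.1 q.2.1, Fin.snoc q.1.2 q.2.2) : (∀ t, X t) × (∀ t, X t)) :=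
      (hs.comp (measurable_fst.prodMap measurable_fst)).prodMk
        (hs.comp (measurable_snd.prodMap measurable_snd))
    set ρ := (π ⊗ₘ L).map fun q =>
      ((Fin.snoc q.1.1 q.2.1, Fin.snoc q.1.2 q.2.2) : (∀ t, X t) × (∀ t, X t)) with hρ
    have hρP : IsProbabilityMeasure ρ := Measure.isProbabilityMeasure_map hr.aemeasurable
    have hρi : ρ.map (Prod.map Fin.init Fin.init) = π := by
      rw [hρ, Measure.map_map (hi.prodMap hi) hr]
      refine Eq.trans ?_ (Measure.fst_compProd π L)
      rw [Measure.fst]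
      congr 1; ext q : 1
      simp
    refine ⟨ρ, hρP, ⟨?_, ?_⟩, ?_, ?_, ?_⟩
    · have h := map_compProd_of_map_eq π L K measurable_fst measurable_fst hL1
      rw [hπ1, hdis] at h
      rw [← hsnoc μ, ← h, hρ, Measure.map_map measurable_fst hr,
        Measure.map_map hs (measurable_fst.prodMap measurable_fst)]
      rfl
    · have h := map_compProd_of_map_eq π L K' measurable_snd measurable_snd hL2
      rw [hπ2, hdis] at h
      rw [← hsnoc μ', ← h, hρ, Measure.map_map measurable_snd hr,
        Measure.map_map hs (measurable_snd.prodMap measurable_snd)]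
      rfl
    · refine HasCausalCondProb.of_last hρi hc K ?_
      have h := map_compProd_of_map_eq π L (K.comap Prod.fst measurable_fst) measurable_id
        measurable_fst hL1
      rw [Measure.map_id] at h
      rw [← h, hρ, Measure.map_map _ hr]
      · congr 1; ext q : 1
        simp [Prod.map_def]
      · exact (hi.prodMap hi).prodMk ((measurable_pi_apply _).comp measurable_fst)
    · have := Measure.isProbabilityMeasure_map (μ := ρ) measurable_swap.aemeasurable
      refine HasCausalCondProb.of_last (π := π.map Prod.swap) ?_ hc' K' ?_
      · rw [← hρi, Measure.map_map (hi.prodMap hi) measurable_swap,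
          Measure.map_map measurable_swap (hi.prodMap hi)]
        rfl
      · have h := map_compProd_of_map_eq π L (K'.comap Prod.fst measurable_fst) measurable_swap
          measurable_snd hL2
        rw [← h, hρ, Measure.map_map measurable_swap hr, Measure.map_map _
          (measurable_swap.comp hr)]
        · congr 1; ext q : 1
          simp [Prod.map_def, Prod.swap]
        · exact (hi.prodMap hi).prodMk ((measurable_pi_apply _).comp measurable_fst)
    · have hne : MeasurableSet {z : (∀ t, X t) × (∀ t, X t) | z.1 ≠ z.2} :=
        (measurableSet_eq_fun measurable_fst measurable_snd).compl
      rw [hπ1, hπ2, hdis, hdis] at hLb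
      have hTV1 := TV_map_le μ μ' he
      have hTV2 := TV_map_le μ μ' hi
      have hpow : 2 * ((2 : ℝ≥0∞) ^ n - 1) + 1 = 2 ^ (n + 1) - 1 := by
        rw [ENNReal.mul_sub (by simp), pow_succ', mul_one]
        have h2 : (2 : ℝ≥0∞) ≤ 2 * 2 ^ n :=
          le_mul_of_one_le_right' (one_le_pow₀ one_le_two)
        refine (ENNReal.sub_eq_of_eq_add ENNReal.one_ne_top ?_).symm
        rw [add_assoc, one_add_one_eq_two, tsub_add_cancel_of_le h2]
      rw [hρ, Measure.map_apply hr hne]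
      calc _ ≤ (π ⊗ₘ L) {q | q.1.1 ≠ q.1.2 ∨ q.2.1 ≠ q.2.2} := by
            refine measure_mono fun q hq => ?_
            by_contra hq'
            simp only [mem_ofPred_eq, not_or, not_not] at hq'
            exact hq (by simp only [hq'.1, hq'.2])
        _ ≤ 2 * ((2 ^ n - 1) * TV μ μ') + TV μ μ' := by
            refine hLb.trans (add_le_add ?_ hTV1)
            gcongr
            exact hb.trans (by gcongr)
        _ = (2 ^ (n + 1) - 1) * TV μ μ' := by rw [← hpow]; ring

lemma TV_le_of_isCoupling {A : Type*} [MeasurableSpace A] {μ ν : Measure A} {π : Measure (A × A)}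
    (h : IsCoupling μ ν π) : TV μ ν ≤ π {z | z.1 ≠ z.2} := by
  refine iSup_le fun B => tsub_le_iff_left.2 ?_
  rw [← h.1, ← h.2, Measure.map_apply measurable_fst B.2, Measure.map_apply measurable_snd B.2]
  refine (measure_mono fun z hz => ?_).trans (measure_union_le _ _)
  by_cases hz' : z.1 = z.2
  · left; simpa [← hz'] using hz
  · right; exact hz'

/-- `‖μ − μ̃‖_TV ≤ ‖μ − μ̃‖_AV ≤ (2^N − 1) ‖μ − μ̃‖_TV`. -/
theorem stmt_5 {N : ℕ} (X : Fin N → Type*)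
    [∀ t, MeasurableSpace (X t)] [∀ t, TopologicalSpace (X t)]
    [∀ t, PolishSpace (X t)] [∀ t, BorelSpace (X t)]
    (μ μ' : Measure (∀ t, X t))
    [IsProbabilityMeasure μ] [IsProbabilityMeasure μ'] :
    TV μ μ' ≤ AV μ μ' ∧ AV μ μ' ≤ (2 ^ N - 1) * TV μ μ' := by
  refine ⟨le_iInf fun π => TV_le_of_isCoupling π.2.1, ?_⟩
  obtain ⟨π, _, hπ, hc, hc', hb⟩ := exists_bicausal_coupling X μ μ'
  have := Measure.isProbabilityMeasure_map (μ := π) measurable_swap.aemeasurable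
  exact (iInf_le (fun π : aCouplings .bicausal μ μ' => π.1 {z | z.1 ≠ z.2})
    ⟨π, hπ, hc.isCausal, hc'.isCausal⟩).trans hb

end AOT
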